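/- arXiv:2112.08153 — 2 statements merged into one kernel-verified Lean document; each statement's English description precedes it below -/
import Mathlib

section
/- Let a > 0 and let λ_1, …, λ_N be strictly positive reals. Define z = (Σ_ℓ λ_ℓ⁻¹)/(Σ_ℓ λ_ℓ⁻²) and t*_ℓ = (z − λ_ℓ)/(a λ_ℓ²) for each ℓ. Then: (i) Σ_ℓ t*_ℓ = 0; (ii) for every t ∈ ℝ^N with Σ_ℓ t_ℓ = 0, one has −Σ_ℓ (λ_ℓ t_ℓ + (a/2) λ_ℓ² t_ℓ²) ≤ −Σ_ℓ (λ_ℓ t*_ℓ + (a/2) λ_ℓ² t*_ℓ²), with equality only if t = t*; and (iii) t*_ℓ > 0 if and only if λ_ℓ < z, and t*_ℓ < 0 if and only if λ_ℓ > z. -/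
open BigOperators Finset

/-- Solution of the reduced-form risk-averse planner's problem.
With `z = (Σ λ_ℓ⁻¹)/(Σ λ_ℓ⁻²)` and `t*_ℓ = (z − λ_ℓ)/(a λ_ℓ²)`:
(i) budget balance `Σ t*_ℓ = 0`; (ii) `t*` is the unique maximizer of the
planner's mean–variance payoff over budget-balanced `t`; (iii) eigenbundles with
`λ_ℓ < z` are taxed (`t*_ℓ > 0`) and those with `λ_ℓ > z` subsidized. -/
theorem stmt_2 (N : ℕ) (a : ℝ) (ha : 0 < a)
    (lam : Fin N → ℝ) (hlam : ∀ ℓ, 0 < lam ℓ)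
    (z : ℝ) (hz : z = (∑ ℓ, (lam ℓ)⁻¹) / (∑ ℓ, ((lam ℓ) ^ 2)⁻¹))
    (tstar : Fin N → ℝ)
    (htstar : ∀ ℓ, tstar ℓ = (z - lam ℓ) / (a * (lam ℓ) ^ 2)) :
    (∑ ℓ, tstar ℓ = 0) ∧
    (∀ t : Fin N → ℝ, (∑ ℓ, t ℓ = 0) →
      (-∑ ℓ, (lam ℓ * t ℓ + (a / 2) * (lam ℓ) ^ 2 * (t ℓ) ^ 2) ≤
        -∑ ℓ, (lam ℓ * tstar ℓ + (a / 2) * (lam ℓ) ^ 2 * (tstar ℓ) ^ 2)) ∧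
      ((-∑ ℓ, (lam ℓ * t ℓ + (a / 2) * (lam ℓ) ^ 2 * (t ℓ) ^ 2) =
        -∑ ℓ, (lam ℓ * tstar ℓ + (a / 2) * (lam ℓ) ^ 2 * (tstar ℓ) ^ 2)) → t = tstar)) ∧
    (∀ ℓ, (0 < tstar ℓ ↔ lam ℓ < z) ∧ (tstar ℓ < 0 ↔ z < lam ℓ)) := by
  have hN : z * ∑ ℓ, ((lam ℓ) ^ 2)⁻¹ = ∑ ℓ, (lam ℓ)⁻¹ := by
    rcases Nat.eq_zero_or_pos N with rfl | hpos
    · simp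
    · have : Nonempty (Fin N) := ⟨⟨0, hpos⟩⟩
      have hsum : 0 < ∑ ℓ, ((lam ℓ) ^ 2)⁻¹ :=
        Finset.sum_pos (fun ℓ _ => inv_pos.2 (pow_pos (hlam ℓ) 2)) Finset.univ_nonempty
      rw [hz, div_mul_cancel₀ _ hsum.ne']
  have hbal : ∑ ℓ, tstar ℓ = 0 := by
    have h : ∀ ℓ, tstar ℓ = a⁻¹ * (z * ((lam ℓ) ^ 2)⁻¹ - (lam ℓ)⁻¹) := fun ℓ => by
      have := (hlam ℓ).ne'
      rw [htstar]
      field_simp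
    simp_rw [h]
    rw [← Finset.mul_sum, Finset.sum_sub_distrib, ← Finset.mul_sum, hN, sub_self, mul_zero]
  refine ⟨hbal, fun t ht => ?_, fun ℓ => ?_⟩
  · have hfoc : ∀ ℓ, a * (lam ℓ) ^ 2 * tstar ℓ = z - lam ℓ := fun ℓ => by
      have := (hlam ℓ).ne'
      rw [htstar]
      field_simp
    have hgap : ∑ ℓ, (lam ℓ * t ℓ + (a / 2) * (lam ℓ) ^ 2 * (t ℓ) ^ 2) =
        ∑ ℓ, (lam ℓ * tstar ℓ + (a / 2) * (lam ℓ) ^ 2 * (tstar ℓ) ^ 2) +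
          ∑ ℓ, (a / 2) * (lam ℓ) ^ 2 * (t ℓ - tstar ℓ) ^ 2 := by
      have hz0 : ∑ ℓ, z * (t ℓ - tstar ℓ) = 0 := by
        rw [← Finset.mul_sum, Finset.sum_sub_distrib, ht, hbal, sub_self, mul_zero]
      rw [← add_zero (_ + _), ← hz0, ← Finset.sum_add_distrib, ← Finset.sum_add_distrib]
      refine Finset.sum_congr rfl fun ℓ _ => ?_
      linear_combination (t ℓ - tstar ℓ) * hfoc ℓ
    have hnn : ∀ ℓ ∈ Finset.univ, 0 ≤ (a / 2) * (lam ℓ) ^ 2 * (t ℓ - tstar ℓ) ^ 2 :=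
      fun ℓ _ => by positivity
    refine ⟨by linarith [Finset.sum_nonneg hnn], fun heq => funext fun ℓ => ?_⟩
    have hzero := (Finset.sum_eq_zero_iff_of_nonneg hnn).1 (by linarith) ℓ (Finset.mem_univ ℓ)
    have hcoef : (a / 2) * (lam ℓ) ^ 2 ≠ 0 := by
      have := hlam ℓ
      positivity
    exact sub_eq_zero.1 (pow_eq_zero_iff two_ne_zero |>.1 ((mul_eq_zero.1 hzero).resolve_left hcoef))
  · have hden : 0 < a * (lam ℓ) ^ 2 := mul_pos ha (pow_pos (hlam ℓ) 2)
    rw [htstar, div_pos_iff_of_pos_right hden, div_lt_iff₀ hden, zero_mul, sub_pos, sub_neg]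
    exact ⟨Iff.rfl, Iff.rfl⟩
end

section
/- Let σ_1, …, σ_N be reals with σ_ℓ ≠ 1 for every ℓ and Σ_ℓ σ_ℓ = −N. Let var[σ] = (1/N)·Σ_ℓ σ_ℓ² − ((1/N)·Σ_ℓ σ_ℓ)² be their sample variance, set λ_ℓ = 1/(1 − σ_ℓ) and z = 1/(2 + var[σ]/2). Then −Σ_ℓ (z − λ_ℓ)/λ_ℓ = N · var[σ]/(4 + var[σ]). -/
open BigOperators

/-- Pigouvian leverage formula. With eigenvalues summing to `−N`,
pass-throughs `λ_ℓ = 1/(1−σ_ℓ)` and shadow price `z = 1/(2 + var[σ]/2)`, the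
rescaled gain in consumer surplus `−Σ_ℓ (z − λ_ℓ)/λ_ℓ` equals
`N·var[σ]/(4 + var[σ])`. -/
theorem stmt_3 (N : ℕ) (hN : 0 < N) (σ : Fin N → ℝ)
    (hσ : ∀ ℓ, σ ℓ ≠ 1) (hsum : ∑ ℓ, σ ℓ = -(N : ℝ))
    (v : ℝ) (hv : v = (1 / (N : ℝ)) * ∑ ℓ, (σ ℓ) ^ 2 - ((1 / (N : ℝ)) * ∑ ℓ, σ ℓ) ^ 2)
    (lam : Fin N → ℝ) (hlam : ∀ ℓ, lam ℓ = 1 / (1 - σ ℓ))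
    (z : ℝ) (hz : z = 1 / (2 + v / 2)) :
    -∑ ℓ, (z - lam ℓ) / lam ℓ = (N : ℝ) * v / (4 + v) := by
  have hN' : (N : ℝ) ≠ 0 := by positivity
  have hv4 : 0 < 4 + v := by
    have hmean : 1 / (N : ℝ) * ∑ ℓ, σ ℓ = -1 := by
      rw [hsum]
      field_simp
    have hsq : 0 ≤ 1 / (N : ℝ) * ∑ ℓ, σ ℓ ^ 2 := by positivity
    rw [hmean] at hv
    linarith
  have hterm : ∀ ℓ, (z - lam ℓ) / lam ℓ = z * (1 - σ ℓ) - 1 := by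
    intro ℓ
    have h : 1 - σ ℓ ≠ 0 := sub_ne_zero.mpr (hσ ℓ).symm
    rw [hlam]
    field_simp
  have hz' : z = 2 / (4 + v) := by
    rw [hz, div_eq_div_iff (by linarith) hv4.ne']
    ring
  simp only [hterm, Finset.sum_sub_distrib, ← Finset.mul_sum, hsum, Finset.sum_const,
    Finset.card_univ, Fintype.card_fin, nsmul_eq_mul]
  rw [hz']
  field_simp
  ring
end
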